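/- Let d ≥ 2 and N ≥ 2. Every 1-uniform state ψ of N qudits with d levels having minimal support (exactly d nonzero coefficients) is LU-equivalent to the generalized GHZ state: there exist unitary d×d matrices U_1,…,U_N such that (U_1⊗⋯⊗U_N)ψ = GHZ_d^N, where GHZ_d^N(x) = 1/√d if x is a constant function and 0 otherwise. -/

import Mathlib

open scoped ComplexConjugate

/-- Glue a function on `S` and a function on `Sᶜ` into a function on all parties. -/
def glue {N d : ℕ} (S : Finset (Fin N)) (x : {i // i ∈ S} → Fin d)
    (z : {i // i ∈ Sᶜ} → Fin d) : Fin N → Fin d :=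
  fun i => if h : i ∈ S then x ⟨i, h⟩ else z ⟨i, Finset.mem_compl.mpr h⟩

/-- Reduced density matrix of `ψ` on the subset `S` of parties. -/
noncomputable def rdm {N d : ℕ} (S : Finset (Fin N)) (ψ : (Fin N → Fin d) → ℂ) :
    Matrix ({i // i ∈ S} → Fin d) ({i // i ∈ S} → Fin d) ℂ :=
  fun x y => ∑ z : {i // i ∈ Sᶜ} → Fin d, ψ (glue S x z) * conj (ψ (glue S y z))

/-- `ψ` is `k`-uniform: every `k`-party reduced density matrix is maximally mixed. -/
def IsKUniform (N d k : ℕ) (ψ : (Fin N → Fin d) → ℂ) : Prop :=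
  ∀ S : Finset (Fin N), S.card = k →
    rdm S ψ = (((d : ℂ) ^ k)⁻¹) •
      (1 : Matrix ({i // i ∈ S} → Fin d) ({i // i ∈ S} → Fin d) ℂ)

/-- The support of a state: the set of basis labels with nonzero coefficient. -/
noncomputable def stateSupport {α : Type} [Fintype α] (ψ : α → ℂ) : Finset α :=
  @Finset.filter _ (fun x => ψ x ≠ 0) (Classical.decPred _) Finset.univ

/-- Action of the local operator `O_1 ⊗ ⋯ ⊗ O_N` on a multipartite state. -/
noncomputable def applyLocal {ι α : Type} [Fintype ι] [DecidableEq ι] [Fintype α]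
    [DecidableEq α] (O : ι → Matrix α α ℂ) (ψ : (ι → α) → ℂ) : (ι → α) → ℂ :=
  fun x => ∑ y : ι → α, (∏ i, O i (x i) (y i)) * ψ y

/-- A monomial matrix: exactly one nonzero entry in every row and every column. -/
def IsMonomial {α : Type} [Fintype α] (M : Matrix α α ℂ) : Prop :=
  (∀ i, ∃! j, M i j ≠ 0) ∧ (∀ j, ∃! i, M i j ≠ 0)

/-- The generalized GHZ state of N qudits with d levels:
coefficient 1/√d on constant basis labels, 0 elsewhere. -/
noncomputable def ghzState (N d : ℕ) : (Fin N → Fin d) → ℂ := fun x =>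
  if ∀ i j : Fin N, x i = x j then ((Real.sqrt d : ℂ))⁻¹ else 0

lemma mem_stateSupport {α : Type} [Fintype α] {ψ : α → ℂ} {x : α} :
    x ∈ stateSupport ψ ↔ ψ x ≠ 0 := by
  simp [stateSupport]

lemma glue_singleton_self {N d : ℕ} (i : Fin N) (x : {j // j ∈ ({i} : Finset (Fin N))} → Fin d)
    (z : {j // j ∈ ({i} : Finset (Fin N))ᶜ} → Fin d) :
    glue {i} x z i = x ⟨i, Finset.mem_singleton_self i⟩ := by
  simp [glue]

lemma glue_apply_compl {N d : ℕ} (S : Finset (Fin N)) (x : {i // i ∈ S} → Fin d)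
    (z : {i // i ∈ Sᶜ} → Fin d) (j : {i // i ∈ Sᶜ}) : glue S x z j = z j := by
  simp [glue, Finset.mem_compl.mp j.2]

lemma glue_restrict {N d : ℕ} (S : Finset (Fin N)) (x : Fin N → Fin d) :
    glue S (fun i => x i) (fun i => x i) = x := by
  ext i
  simp [glue]

/-- The diagonal entries of the one-party marginals of a 1-uniform state are `1 / d`. -/
lemma IsKUniform.sum_glue_singleton {N d : ℕ} {ψ : (Fin N → Fin d) → ℂ}
    (h : IsKUniform N d 1 ψ) (i : Fin N) (a : Fin d) :
    ∑ z : {j // j ∈ ({i} : Finset (Fin N))ᶜ} → Fin d,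
      ψ (glue {i} (fun _ => a) z) * conj (ψ (glue {i} (fun _ => a) z)) = (d : ℂ)⁻¹ := by
  have := congrFun (congrFun (h {i} (Finset.card_singleton i)) fun _ => a) fun _ => a
  simpa [rdm] using this

/-- In a 1-uniform state every level of every party occurs in the support. -/
lemma IsKUniform.exists_ne_zero {N d : ℕ} {ψ : (Fin N → Fin d) → ℂ}
    (h : IsKUniform N d 1 ψ) (i : Fin N) (a : Fin d) : ∃ x, ψ x ≠ 0 ∧ x i = a := by
  have hd : (d : ℂ)⁻¹ ≠ 0 := inv_ne_zero (Nat.cast_ne_zero.mpr (Fin.pos a).ne')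
  rw [← h.sum_glue_singleton i a] at hd
  obtain ⟨z, -, hz⟩ := Finset.exists_ne_zero_of_sum_ne_zero hd
  exact ⟨_, left_ne_zero_of_mul hz, glue_singleton_self ..⟩

/-- A support vector of a 1-uniform state that is determined by its entry at one party has
squared modulus `1 / d`. -/
lemma IsKUniform.mul_conj_eq {N d : ℕ} {ψ : (Fin N → Fin d) → ℂ}
    (h : IsKUniform N d 1 ψ) {i : Fin N} {x : Fin N → Fin d}
    (hx : ∀ y, ψ y ≠ 0 → y i = x i → y = x) : ψ x * conj (ψ x) = (d : ℂ)⁻¹ := by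
  have hglue : glue {i} (fun _ => x i) (fun j => x j) = x := by
    convert glue_restrict {i} x using 2
    ext j
    rw [Finset.mem_singleton.mp j.2]
  rw [← h.sum_glue_singleton i (x i),
    Finset.sum_eq_single fun j : {j // j ∈ ({i} : Finset (Fin N))ᶜ} => x j, hglue]
  · intro z _ hz
    by_contra hne
    refine hz (funext fun j => ?_)
    rw [← hx _ (left_ne_zero_of_mul hne) (glue_singleton_self ..), glue_apply_compl]
  · simp

/-- In a 1-uniform state of minimal support the entry at any party is a bijection from the
support onto the levels. -/
lemma IsKUniform.bijective_eval {N d : ℕ} {ψ : (Fin N → Fin d) → ℂ}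
    (h : IsKUniform N d 1 ψ) (hcard : (stateSupport ψ).card = d) (i : Fin N) :
    Function.Bijective fun x : stateSupport ψ => (x : Fin N → Fin d) i := by
  rw [Fintype.bijective_iff_surjective_and_card]
  refine ⟨fun a => ?_, by simp [hcard]⟩
  obtain ⟨x, hx, rfl⟩ := h.exists_ne_zero i a
  exact ⟨⟨x, mem_stateSupport.mpr hx⟩, rfl⟩

/-- The matrix sending the basis vector `π a` to `c a` times the basis vector `a`. -/
def weightedPerm {α : Type} [DecidableEq α] (π : Equiv.Perm α) (c : α → ℂ) : Matrix α α ℂ :=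
  fun a b => if π a = b then c a else 0

open Matrix in
lemma weightedPerm_conjTranspose_mul_self {α : Type} [Fintype α] [DecidableEq α]
    (π : Equiv.Perm α) {c : α → ℂ} (hc : ∀ a, c a * conj (c a) = 1) :
    (weightedPerm π c)ᴴ * weightedPerm π c = 1 := by
  rw [mul_eq_one_comm]
  ext a b
  by_cases hab : a = b
  · subst hab
    simp [Matrix.mul_apply, weightedPerm, hc]
  · simp [Matrix.mul_apply, weightedPerm, hab, Ne.symm hab]

lemma applyLocal_weightedPerm {ι α : Type} [Fintype ι] [DecidableEq ι] [Fintype α]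
    [DecidableEq α] (π : ι → Equiv.Perm α) (c : ι → α → ℂ) (ψ : (ι → α) → ℂ) (x : ι → α) :
    applyLocal (fun i => weightedPerm (π i) (c i)) ψ x =
      (∏ i, c i (x i)) * ψ fun i => π i (x i) := by
  rw [applyLocal, Finset.sum_eq_single fun i => π i (x i)]
  · simp [weightedPerm]
  · intro y _ hy
    obtain ⟨i, hi⟩ := Function.ne_iff.mp hy
    rw [Finset.prod_eq_zero (Finset.mem_univ i) (if_neg hi.symm), zero_mul]
  · simp

open Matrix in
/-- Every 1-uniform state of N ≥ 2 qudits with d ≥ 2 levels having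
minimal support is LU-equivalent to the generalized GHZ state. -/
theorem oneUniform_minSupport_lu_ghz (d N : ℕ) (hd : 2 ≤ d) (hN : 2 ≤ N)
    (ψ : (Fin N → Fin d) → ℂ)
    (hψnorm : (∑ x, Complex.normSq (ψ x)) = 1)
    (hψuni : IsKUniform N d 1 ψ)
    (hψsupp : (stateSupport ψ).card = d) :
    ∃ U : Fin N → Matrix (Fin d) (Fin d) ℂ,
      (∀ i, (U i)ᴴ * U i = 1) ∧ applyLocal U ψ = ghzState N d := by
  let i₀ : Fin N := ⟨0, by omega⟩
  let E (i : Fin N) : stateSupport ψ ≃ Fin d :=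
    Equiv.ofBijective _ (hψuni.bijective_eval hψsupp i)
  let e : Fin d ≃ stateSupport ψ := (E i₀).symm
  let π (i : Fin N) : Equiv.Perm (Fin d) := e.trans (E i)
  have hnorm (a : Fin d) : ψ (e a) * conj (ψ (e a)) = (d : ℂ)⁻¹ :=
    hψuni.mul_conj_eq (i := i₀) fun y hy hya => congrArg Subtype.val
      ((hψuni.bijective_eval hψsupp i₀).injective
        (a₁ := ⟨y, mem_stateSupport.mpr hy⟩) (a₂ := e a) hya)
  have hsqrt : (Real.sqrt d : ℂ) * Real.sqrt d = d := by
    rw [← Complex.ofReal_mul, Real.mul_self_sqrt d.cast_nonneg, Complex.ofReal_natCast]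
  have hd0 : (d : ℂ) ≠ 0 := Nat.cast_ne_zero.mpr (by omega)
  have hs0 : (Real.sqrt d : ℂ) ≠ 0 := left_ne_zero_of_mul (hsqrt ▸ hd0)
  let c (i : Fin N) (a : Fin d) : ℂ := if i = i₀ then Real.sqrt d * conj (ψ (e a)) else 1
  refine ⟨fun i => weightedPerm (π i) (c i),
    fun i => weightedPerm_conjTranspose_mul_self _ fun a => ?_, funext fun x => ?_⟩
  · by_cases hi : i = i₀
    · simp only [c, if_pos hi, map_mul, Complex.conj_ofReal, Complex.conj_conj]
      calc _ = ((Real.sqrt d : ℂ) * Real.sqrt d) * (ψ (e a) * conj (ψ (e a))) := by ring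
        _ = 1 := by rw [hsqrt, hnorm, mul_inv_cancel₀ hd0]
    · simp [c, hi]
  · rw [applyLocal_weightedPerm, ghzState]
    split_ifs with hx
    · have hπ : (fun i => π i (x i)) = e (x i₀) := by
        ext i
        rw [hx i i₀]
        rfl
      have hc : ∏ i, c i (x i) = Real.sqrt d * conj (ψ (e (x i₀))) := by simp [c]
      rw [hπ, hc, mul_assoc, mul_comm (conj _), hnorm, ← hsqrt]
      field_simp
    · refine mul_eq_zero_of_right _ (by_contra fun hne => hx ?_)
      obtain ⟨k, hk⟩ := e.surjective ⟨_, mem_stateSupport.mpr hne⟩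
      have hxk (i : Fin N) : x i = k :=
        (π i).injective (congrFun (congrArg Subtype.val hk) i).symm
      exact fun i j => (hxk i).trans (hxk j).symm
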